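/- Set m = 1 + max(r*, t) and c = exp(exp(exp(m·(4 + 7/log m)))). Then for every positive integer a there exists an integer b with a < b < c·a such that v_{a,b} < v_{a,b-1}. -/

import Mathlib

open Finset

/-- `Lab r a b` is the least common multiple of those `i ∈ {a,…,b}` with `r i ≠ 0`
(equal to `1` if there are none). -/
def Lab (r : ℕ → ℤ) (a b : ℕ) : ℕ :=
  ((Finset.Icc a b).filter fun i => r i ≠ 0).lcm id

/-- `Xab r a b = L_{a,b} · Σ_{i=a}^b r_i / i`, as an integer. -/
def Xab (r : ℕ → ℤ) (a b : ℕ) : ℤ :=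
  ∑ i ∈ Finset.Icc a b, r i * ((Lab r a b / i : ℕ) : ℤ)

def gab (r : ℕ → ℤ) (a b : ℕ) : ℕ :=
  Int.gcd (Xab r a b) (Lab r a b)

/-- `vab r a b` is the denominator of `Σ_{i=a}^b r_i / i` in lowest terms. -/
def vab (r : ℕ → ℤ) (a b : ℕ) : ℕ :=
  Lab r a b / gab r a b

/-- `r* = max_{1 ≤ i ≤ t} |r_i|`. -/
def rstar (r : ℕ → ℤ) (t : ℕ) : ℕ :=
  (Finset.Icc 1 t).sup fun i => (r i).natAbs

/-- The partial sum `Σ_{i=a}^b r_i / i`. -/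
def psum (r : ℕ → ℤ) (a b : ℕ) : ℚ := ∑ i ∈ Icc a b, (r i : ℚ) / i

lemma vab_eq_den_psum (r : ℕ → ℤ) {a : ℕ} (b : ℕ) (ha : 1 ≤ a) :
    vab r a b = (psum r a b).den := by
  have hL : Lab r a b ≠ 0 := by
    unfold Lab
    rw [Ne, Finset.lcm_eq_zero_iff]
    simp only [id]
    rintro ⟨i, hi, rfl⟩
    simp at hi
    omega
  have hX : (Xab r a b : ℚ) = psum r a b * (Lab r a b : ℚ) := by
    unfold Xab psum
    push_cast
    rw [Finset.sum_mul]
    refine Finset.sum_congr rfl fun i hi => ?_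
    by_cases hr : r i = 0
    · simp [hr]
    have hd : i ∣ Lab r a b := by
      unfold Lab
      exact Finset.dvd_lcm (f := id) (Finset.mem_filter.mpr ⟨hi, hr⟩)
    have hi0 : (i : ℚ) ≠ 0 := by
      have := (Finset.mem_Icc.mp hi).1
      exact_mod_cast (by omega : i ≠ 0)
    have hc : (((Lab r a b : ℤ) / (i : ℤ) : ℤ) : ℚ) = (Lab r a b : ℚ) / i := by
      rw [Int.cast_div (by exact_mod_cast hd) (by exact_mod_cast hi0)]
      simp
    rw [hc]
    field_simp
  have hL' : (Lab r a b : ℚ) ≠ 0 := by exact_mod_cast hL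
  have hS : psum r a b = Rat.divInt (Xab r a b) (Lab r a b) := by
    rw [Rat.divInt_eq_div, hX]; push_cast; field_simp
  rw [hS, Rat.den_divInt]
  simp [hL, vab, gab, Int.gcd_comm]

section padic
variable {p : ℕ} [hp : Fact p.Prime]

lemma padicNorm_eq_of_den (x : ℚ) :
    padicNorm p x = padicNorm p x.num / padicNorm p x.den := by
  conv_lhs => rw [← Rat.num_div_den x]
  exact padicNorm.div _ _

lemma padicNorm_num_eq_one {x : ℚ} (h : p ∣ x.den) : padicNorm p x.num = 1 := by
  rw [padicNorm.int_eq_one_iff]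
  intro h'
  have := Nat.dvd_gcd (Int.natCast_dvd.mp h') h
  rw [x.reduced] at this
  exact hp.out.one_lt.ne' (Nat.dvd_one.mp this)

lemma padicNorm_den_eq_one {x : ℚ} (h : (p : ℤ) ∣ x.num) : padicNorm p x.den = 1 := by
  rw [padicNorm.nat_eq_one_iff]
  intro h'
  have := Nat.dvd_gcd (Int.natCast_dvd.mp h) h'
  rw [x.reduced] at this
  exact hp.out.one_lt.ne' (Nat.dvd_one.mp this)

lemma padicNorm_natCast_pos {n : ℕ} (h : n ≠ 0) : 0 < padicNorm p n :=
  lt_of_le_of_ne (padicNorm.nonneg _) (padicNorm.nonzero (by exact_mod_cast h)).symm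

lemma pow_le_padicNorm_of_dvd_den {x : ℚ} {k : ℕ} (hk : k ≠ 0) (h : p ^ k ∣ x.den) :
    (p : ℚ) ^ k ≤ padicNorm p x := by
  rw [padicNorm_eq_of_den, padicNorm_num_eq_one ((dvd_pow_self p hk).trans h)]
  have h1 : padicNorm p (x.den : ℤ) ≤ (p : ℚ) ^ (-k : ℤ) :=
    padicNorm.dvd_iff_norm_le.mp (by exact_mod_cast h)
  rw [Int.cast_natCast, zpow_neg, zpow_natCast] at h1
  have hpos := padicNorm_natCast_pos (p := p) x.den_ne_zero
  have hp0 : (0 : ℚ) < (p : ℚ) ^ k := by have := hp.out.pos; positivity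
  rw [le_div_iff₀ hpos]
  calc (p : ℚ) ^ k * padicNorm p x.den ≤ p ^ k * ((p : ℚ) ^ k)⁻¹ := by gcongr
    _ = 1 := mul_inv_cancel₀ hp0.ne'

lemma pow_dvd_den_of_lt_padicNorm {x : ℚ} {k : ℕ}
    (h : (p : ℚ) ^ ((k : ℤ) - 1) < padicNorm p x) : p ^ k ∣ x.den := by
  have hp0 : (0 : ℚ) < (p : ℚ) := by have := hp.out.pos; positivity
  have hx : (x.den : ℚ) ≠ 0 := by exact_mod_cast x.den_ne_zero
  have hpos := padicNorm_natCast_pos (p := p) x.den_ne_zero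
  rw [padicNorm_eq_of_den, lt_div_iff₀ hpos] at h
  have h1 : (p : ℚ) ^ ((k : ℤ) - 1) * padicNorm p x.den < 1 :=
    h.trans_le (padicNorm.of_int _)
  have h2 : padicNorm p ((x.den : ℤ) : ℚ) ≤ (p : ℚ) ^ (-k : ℤ) := by
    obtain ⟨z, hz⟩ := padicNorm.values_discrete (p := p) hx
    rw [Int.cast_natCast, hz]
    rw [hz, ← zpow_add₀ hp0.ne'] at h1
    have hp1 : (1 : ℚ) < p := by exact_mod_cast hp.out.one_lt
    have : (k : ℤ) - 1 + -z < 0 := by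
      by_contra hcon
      exact absurd h1 (not_lt.mpr (one_le_zpow₀ hp1.le (not_lt.mp hcon)))
    exact zpow_le_zpow_right₀ hp1.le (by omega)
  exact_mod_cast padicNorm.dvd_iff_norm_le.mpr h2

lemma padicNorm_le_of_pow_dvd_num {x : ℚ} {k : ℕ} (hk : k ≠ 0) (h : ((p ^ k : ℕ) : ℤ) ∣ x.num) :
    padicNorm p x ≤ ((p : ℚ) ^ k)⁻¹ := by
  have h0 : (p : ℤ) ∣ x.num :=
    (by exact_mod_cast dvd_pow_self (p : ℤ) hk : (p : ℤ) ∣ ((p ^ k : ℕ) : ℤ)).trans h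
  rw [padicNorm_eq_of_den, padicNorm_den_eq_one h0, div_one]
  simpa using padicNorm.dvd_iff_norm_le.mp h

lemma padicNorm_pow_inv (k : ℕ) : padicNorm p (((p : ℚ) ^ k)⁻¹) = (p : ℚ) ^ k := by
  have : padicNorm p ((p : ℚ) ^ k) = ((p : ℚ) ^ k)⁻¹ := by
    induction k with
    | zero => simp
    | succ k ih => rw [pow_succ, padicNorm.mul, ih, padicNorm.padicNorm_p_of_prime, mul_inv]
  rw [← one_div, padicNorm.div, this, padicNorm.one, one_div, inv_inv]

lemma padicNorm_int_div_nat_le {z : ℤ} {i k : ℕ} (h : ¬ p ^ k ∣ i) :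
    padicNorm p ((z : ℚ) / i) ≤ (p : ℚ) ^ ((k : ℤ) - 1) := by
  by_contra hcon
  have h1 := pow_dvd_den_of_lt_padicNorm (not_le.mp hcon)
  refine h (h1.trans ?_)
  have := Rat.den_dvd z i
  rw [Rat.divInt_eq_div] at this
  exact_mod_cast this

end padic

section periodic
variable {t : ℕ} {r : ℕ → ℤ}

lemma eq_of_modEq_of_periodic (hper : ∀ i, 1 ≤ i → r (i + t) = r i) {i j : ℕ}
    (hi : 1 ≤ i) (hj : 1 ≤ j) (h : i ≡ j [MOD t]) : r i = r j := by
  have key : ∀ k i, 1 ≤ i → r (i + t * k) = r i := by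
    intro k
    induction k with
    | zero => simp
    | succ k ih =>
      intro i hi
      rw [Nat.mul_succ, ← add_assoc, hper _ (by omega), ih i hi]
  wlog hij : i ≤ j generalizing i j
  · exact (this hj hi h.symm (by omega)).symm
  obtain ⟨k, hk⟩ := (Nat.modEq_iff_dvd' hij).mp h
  have : j = i + t * k := by omega
  rw [this, key k i hi]

lemma exists_mul_apply_ne_zero (ht : 1 ≤ t) (hper : ∀ i, 1 ≤ i → r (i + t) = r i)
    (hnz : ∃ i, 1 ≤ i ∧ r i ≠ 0) {u : ℕ} (hu : 1 ≤ u) (hut : u.Coprime t) :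
    ∃ j, 1 ≤ j ∧ j ≤ t ∧ r (u * j) ≠ 0 := by
  obtain ⟨i, hi, hri⟩ := hnz
  have hφ : 1 ≤ t.totient := Nat.totient_pos.mpr ht
  set v := u ^ (t.totient - 1) * i with hv
  have hv1 : 1 ≤ v := Nat.mul_pos (pow_pos hu _) hi
  have huv : u * v ≡ i [MOD t] := by
    have : u * v = u ^ t.totient * i := by
      rw [hv, ← mul_assoc, ← pow_succ', Nat.sub_add_cancel hφ]
    rw [this]
    simpa using (Nat.ModEq.pow_totient hut).mul_right i
  have hj : (v - 1) % t + 1 ≡ v [MOD t] := by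
    have := (Nat.mod_modEq (v - 1) t).add_right 1
    rwa [Nat.sub_add_cancel hv1] at this
  refine ⟨(v - 1) % t + 1, by omega, Nat.mod_lt _ ht, ?_⟩
  rwa [eq_of_modEq_of_periodic hper (Nat.mul_pos hu (by omega)) hi ((hj.mul_left u).trans huv)]

lemma padicNorm_psum_sub_block_le {p : ℕ} [hp : Fact p.Prime] {a k : ℕ} (N : ℕ) (ha : 1 ≤ a)
    (hak : a ≤ p ^ k) :
    padicNorm p (psum r a N - ((p : ℚ) ^ k)⁻¹ * psum (fun j => r (p ^ k * j)) 1 (N / p ^ k)) ≤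
      (p : ℚ) ^ ((k : ℤ) - 1) := by
  have hpk : 0 < p ^ k := pow_pos hp.out.pos k
  have h1 : ∑ i ∈ (Icc a N).filter (fun i => p ^ k ∣ i), (r i : ℚ) / i =
      ((p : ℚ) ^ k)⁻¹ * psum (fun j => r (p ^ k * j)) 1 (N / p ^ k) := by
    unfold psum
    rw [Finset.mul_sum]
    refine Finset.sum_nbij' (fun i => i / p ^ k) (fun j => p ^ k * j) ?_ ?_ ?_ ?_ ?_
    · intro i hi
      simp only [Finset.mem_filter, Finset.mem_Icc] at hi ⊢
      exact ⟨Nat.div_pos (Nat.le_of_dvd (by omega) hi.2) hpk, Nat.div_le_div_right hi.1.2⟩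
    · intro j hj
      simp only [Finset.mem_filter, Finset.mem_Icc] at hj ⊢
      exact ⟨⟨hak.trans (Nat.le_mul_of_pos_right _ hj.1),
        (Nat.mul_le_mul_left _ hj.2).trans (Nat.mul_div_le _ _)⟩, dvd_mul_right _ _⟩
    · intro i hi
      exact Nat.mul_div_cancel' (Finset.mem_filter.mp hi).2
    · intro j _
      exact Nat.mul_div_cancel_left _ hpk
    · intro i hi
      have hd := (Finset.mem_filter.mp hi).2
      obtain ⟨j, rfl⟩ := hd
      rw [Nat.mul_div_cancel_left _ hpk]
      push_cast
      rw [div_mul_eq_div_div, div_eq_mul_inv (r (p ^ k * j) : ℚ), mul_comm (r (p ^ k * j) : ℚ),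
        mul_div_assoc]
  have h2 : psum r a N - ((p : ℚ) ^ k)⁻¹ * psum (fun j => r (p ^ k * j)) 1 (N / p ^ k) =
      ∑ i ∈ (Icc a N).filter (fun i => ¬ p ^ k ∣ i), (r i : ℚ) / i := by
    rw [← h1, psum, ← Finset.sum_filter_add_sum_filter_not (Icc a N) (fun i => p ^ k ∣ i)]
    ring
  rw [h2]
  refine padicNorm.sum_le' (fun i hi => padicNorm_int_div_nat_le (Finset.mem_filter.mp hi).2) ?_
  have := hp.out.pos
  positivity

lemma vab_lt_of_block {p : ℕ} [hp : Fact p.Prime] {a k g w b : ℕ} (hk : k ≠ 0) (ha : 1 ≤ a)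
    (hak : a ≤ p ^ k) (hb : b = p ^ k * (g * w)) (hab : a < b) (hpg : ¬ p ∣ g * w)
    (hrb : ¬ (p : ℤ) ∣ r b)
    (hS : padicNorm p (psum (fun j => r (p ^ k * j)) 1 (g * w)) ≤ (p : ℚ)⁻¹)
    (hg : g ∣ vab r a (b - 1)) (hw : w < p) : vab r a b < vab r a (b - 1) := by
  rw [vab_eq_den_psum r _ ha] at hg
  rw [vab_eq_den_psum r _ ha, vab_eq_den_psum r _ ha]
  have hp0 : (0 : ℚ) < p := by exact_mod_cast hp.out.pos
  have hp1 : (1 : ℚ) < p := by exact_mod_cast hp.out.one_lt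
  have hT : psum r a b = psum r a (b - 1) + (r b : ℚ) / b := by
    unfold psum
    obtain ⟨c, rfl⟩ : ∃ c, b = c + 1 := ⟨b - 1, by omega⟩
    rw [Finset.sum_Icc_succ_top (by omega)]
    simp
  have hdiv : b / p ^ k = g * w := by
    rw [hb, Nat.mul_div_cancel_left _ (pow_pos hp.out.pos k)]
  have hnT : padicNorm p (psum r a b) ≤ (p : ℚ) ^ ((k : ℤ) - 1) := by
    have h1 := padicNorm_psum_sub_block_le (r := r) (p := p) b ha hak
    rw [hdiv] at h1
    have h2 : padicNorm p (((p : ℚ) ^ k)⁻¹ * psum (fun j => r (p ^ k * j)) 1 (g * w)) ≤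
        (p : ℚ) ^ ((k : ℤ) - 1) := by
      rw [padicNorm.mul, padicNorm_pow_inv, zpow_sub₀ hp0.ne', zpow_natCast, zpow_one,
        div_eq_mul_inv]
      gcongr
    have h3 := padicNorm.nonarchimedean (p := p)
      (q := psum r a b - ((p : ℚ) ^ k)⁻¹ * psum (fun j => r (p ^ k * j)) 1 (g * w))
      (r := ((p : ℚ) ^ k)⁻¹ * psum (fun j => r (p ^ k * j)) 1 (g * w))
    rw [sub_add_cancel] at h3
    exact h3.trans (max_le h1 h2)
  have hnb : padicNorm p ((r b : ℚ) / b) = (p : ℚ) ^ k := by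
    have h1 : ((r b : ℚ) / b) = ((p : ℚ) ^ k)⁻¹ * ((r b : ℚ) / ((g * w : ℕ) : ℚ)) := by
      rw [hb]
      push_cast
      rw [div_mul_eq_div_div, div_eq_mul_inv _ ((p : ℚ) ^ k), mul_comm _ ((p : ℚ) ^ k)⁻¹,
        mul_div_assoc]
    rw [h1, padicNorm.mul, padicNorm_pow_inv, padicNorm.div,
      (padicNorm.int_eq_one_iff _).mpr hrb, (padicNorm.nat_eq_one_iff _).mpr hpg]
    simp
  have hpk : p ^ k ∣ (psum r a (b - 1)).den := by
    apply pow_dvd_den_of_lt_padicNorm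
    by_contra hcon
    have h1 := padicNorm.sub (p := p) (q := psum r a b) (r := psum r a (b - 1))
    rw [hT, add_sub_cancel_left, ← hT, hnb] at h1
    have h2 : (p : ℚ) ^ k ≤ (p : ℚ) ^ ((k : ℤ) - 1) := h1.trans (max_le hnT (not_lt.mp hcon))
    rw [← zpow_natCast] at h2
    exact absurd h2 (not_le.mpr (zpow_lt_zpow_right₀ hp1 (by omega)))
  have hpT : ¬ p ^ k ∣ (psum r a b).den := by
    intro h
    have h1 := (pow_le_padicNorm_of_dvd_den hk h).trans hnT
    rw [← zpow_natCast] at h1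
    exact absurd h1 (not_le.mpr (zpow_lt_zpow_right₀ hp1 (by omega)))
  have hgw : g * w ≠ 0 := fun h => hpg (h ▸ dvd_zero p)
  have hcop : (p ^ k).Coprime g :=
    Nat.Coprime.pow_left k ((Nat.Prime.coprime_iff_not_dvd hp.out).mpr
      fun h => hpg (h.mul_right w))
  obtain ⟨V', hV'⟩ := hcop.mul_dvd_of_dvd_of_dvd hpk hg
  have hdvd : (psum r a b).den ∣ (psum r a (b - 1)).den * w := by
    have h1 : psum r a b = Rat.divInt ((psum r a (b - 1)).num * w + r b * V')
        (((psum r a (b - 1)).den * w : ℕ) : ℤ) := by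
      have hg0 : (g : ℚ) ≠ 0 := by exact_mod_cast (Nat.mul_ne_zero_iff.mp hgw).1
      have hw0 : (w : ℚ) ≠ 0 := by exact_mod_cast (Nat.mul_ne_zero_iff.mp hgw).2
      have hd0 : ((psum r a (b - 1)).den : ℚ) ≠ 0 := by exact_mod_cast Rat.den_ne_zero _
      have hb' : (b : ℚ) = p ^ k * (g * w) := by exact_mod_cast hb
      have hV'' : ((psum r a (b - 1)).den : ℚ) = p ^ k * g * V' := by exact_mod_cast hV'
      have hV0 : (V' : ℚ) ≠ 0 := by
        intro h
        rw [h, mul_zero] at hV''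
        exact hd0 hV''
      have hbV : (r b : ℚ) / b = r b * V' / ((psum r a (b - 1)).den * w) := by
        rw [hb', hV'']
        field_simp
      rw [Rat.divInt_eq_div, hT, hbV]
      have hx : ((psum r a (b - 1)).num * w : ℚ) / ((psum r a (b - 1)).den * w) =
          psum r a (b - 1) := by
        rw [mul_div_mul_right _ _ hw0, Rat.num_div_den]
      push_cast
      rw [add_div, hx]
    rw [h1]
    exact Int.natCast_dvd_natCast.mp (Rat.den_dvd _ _)
  obtain ⟨e, d, hpd, hd⟩ := Nat.exists_eq_pow_mul_and_not_dvd
    (Rat.den_ne_zero (psum r a b)) p hp.out.ne_one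
  obtain ⟨f, V, hpV, hV⟩ := Nat.exists_eq_pow_mul_and_not_dvd
    (Rat.den_ne_zero (psum r a (b - 1))) p hp.out.ne_one
  have hek : e < k := by
    by_contra hcon
    exact hpT ((pow_dvd_pow p (not_lt.mp hcon)).trans (hd ▸ dvd_mul_right _ _))
  have hkf : k ≤ f := by
    by_contra hcon
    rw [hV] at hpk
    have h1 : p ^ (f + 1) ∣ p ^ f * V := (pow_dvd_pow p (by omega)).trans hpk
    rw [pow_succ] at h1
    exact hpV (Nat.dvd_of_mul_dvd_mul_left (pow_pos hp.out.pos f) h1)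
  have hV0 : 0 < V := Nat.pos_of_ne_zero fun h => hpV (h ▸ dvd_zero p)
  have hw0 : 0 < w := Nat.pos_of_ne_zero (Nat.mul_ne_zero_iff.mp hgw).2
  have hdV : d ≤ V * w := by
    apply Nat.le_of_dvd (Nat.mul_pos hV0 hw0)
    have h1 : d ∣ p ^ f * (V * w) := by
      rw [← mul_assoc, ← hV]
      exact (hd ▸ dvd_mul_left _ _ : d ∣ (psum r a b).den).trans hdvd
    exact Nat.Coprime.dvd_of_dvd_mul_left
      (Nat.Coprime.pow_right f ((Nat.Prime.coprime_iff_not_dvd hp.out).mpr hpd).symm) h1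
  rw [hd, hV]
  calc p ^ e * d ≤ p ^ e * (V * w) := by gcongr
    _ < p ^ e * (V * p) := by
      have := pow_pos hp.out.pos e
      gcongr
    _ = p ^ (e + 1) * V := by ring
    _ ≤ p ^ f * V := by
      gcongr
      · exact hp.out.one_le
      · omega

end periodic

section noDrop
variable {t : ℕ} {r : ℕ → ℤ}

lemma exists_lt_pow_le_mul {y a : ℕ} (hy : 1 < y) (ha : 1 ≤ a) :
    ∃ l, l ≠ 0 ∧ a < y ^ l ∧ y ^ l ≤ a * y :=
  ⟨Nat.log y a + 1, by omega, Nat.lt_pow_succ_log_self hy a, by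
    rw [pow_succ]
    exact Nat.mul_le_mul_right _ (Nat.pow_log_le_self y (by omega))⟩

lemma not_intCast_dvd_of_natAbs_le {M p : ℕ} {z : ℤ} (hz : z ≠ 0) (hM : z.natAbs ≤ M)
    (hp : M < p) : ¬ (p : ℤ) ∣ z := by
  intro h
  have := Nat.le_of_dvd (Int.natAbs_pos.mpr hz) (Int.natCast_dvd.mp h)
  omega

lemma psum_eq_psum_findGreatest (s : ℕ → ℤ) (J : ℕ) :
    psum s 1 J = psum s 1 (Nat.findGreatest (fun j => s j ≠ 0) J) := by
  symm
  refine Finset.sum_subset (Finset.Icc_subset_Icc_right (Nat.findGreatest_le J)) ?_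
  intro j hj hj'
  simp only [Finset.mem_Icc] at hj hj'
  have := Nat.findGreatest_is_greatest (P := fun j => s j ≠ 0) (n := J) (k := j) (by omega) hj.2
  simp only [ne_eq, not_not] at this
  simp [this]

lemma inv_lt_padicNorm_psum_of_noDrop {M C a p J κ : ℕ} (ht : 1 ≤ t)
    (hper : ∀ i, 1 ≤ i → r (i + t) = r i) (hM : ∀ i, 1 ≤ i → (r i).natAbs ≤ M) (htM : t ≤ M)
    (ha : 1 ≤ a) (hno : ∀ b, a < b → b ≤ a * C → vab r a (b - 1) ≤ vab r a b)
    [hp : Fact p.Prime] (hMp : M < p) (hJ : J < p) (hC : p ^ (2 * t + 1) ≤ C)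
    (hex : ∃ j, 1 ≤ j ∧ j ≤ J ∧ r (p ^ κ * j) ≠ 0) :
    (p : ℚ)⁻¹ < padicNorm p (psum (fun j => r (p ^ κ * j)) 1 J) := by
  by_contra hcon
  rw [psum_eq_psum_findGreatest] at hcon
  obtain ⟨j, hj1, hj2, hj3⟩ := hex
  set J₀ := Nat.findGreatest (fun j => r (p ^ κ * j) ≠ 0) J with hJ₀
  have hJr : r (p ^ κ * J₀) ≠ 0 :=
    Nat.findGreatest_spec (P := fun j => r (p ^ κ * j) ≠ 0) hj2 hj3
  have hJ1 : 1 ≤ J₀ := hj1.trans (Nat.le_findGreatest hj2 hj3)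
  have hJp : J₀ < p := (Nat.findGreatest_le J).trans_lt hJ
  have hp1 := hp.out.one_lt
  have hφ : 1 ≤ t.totient := Nat.totient_pos.mpr ht
  have hφt : t.totient ≤ t := Nat.totient_le t
  have hcop : p.Coprime t :=
    (Nat.Prime.coprime_iff_not_dvd hp.out).mpr fun h => by
      have := Nat.le_of_dvd ht h
      omega
  obtain ⟨l, hl0, hal, hla⟩ := exists_lt_pow_le_mul (y := p ^ t.totient) (a := a)
    (Nat.one_lt_pow (by omega) hp1) ha
  set k := t.totient * l + κ % t.totient with hk
  have hpk : p ^ k = (p ^ t.totient) ^ l * p ^ (κ % t.totient) := by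
    rw [hk, pow_add, pow_mul]
  have hmod : p ^ k ≡ p ^ κ [MOD t] := by
    have h1 : (p ^ t.totient) ^ l ≡ 1 [MOD t] := by
      simpa using (Nat.ModEq.pow_totient hcop).pow l
    have h2 : (p ^ t.totient) ^ (κ / t.totient) ≡ 1 [MOD t] := by
      simpa using (Nat.ModEq.pow_totient hcop).pow (κ / t.totient)
    have h3 : p ^ κ = (p ^ t.totient) ^ (κ / t.totient) * p ^ (κ % t.totient) := by
      rw [← pow_mul, ← pow_add, Nat.div_add_mod]
    rw [hpk, h3]
    exact (h1.trans h2.symm).mul_right _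
  have hpos : ∀ n, 1 ≤ p ^ n := fun n => Nat.one_le_pow _ _ hp.out.pos
  have hreq : ∀ j, 1 ≤ j → r (p ^ k * j) = r (p ^ κ * j) := fun j hj =>
    eq_of_modEq_of_periodic hper (Nat.mul_pos (hpos _) hj) (Nat.mul_pos (hpos _) hj)
      (hmod.mul_right j)
  have hlt : a < p ^ k := hpk ▸ hal.trans_le (Nat.le_mul_of_pos_right _ (hpos _))
  have hab : a < p ^ k * (1 * J₀) := by
    rw [one_mul]
    exact hlt.trans_le (Nat.le_mul_of_pos_right _ hJ1)
  have hbound : p ^ k * (1 * J₀) ≤ a * C := by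
    calc p ^ k * (1 * J₀) ≤ (a * p ^ t.totient) * p ^ t.totient * p := by
          rw [hpk, one_mul]
          gcongr
          · exact hp.out.one_le
          · exact (Nat.mod_lt _ hφ).le
      _ = a * p ^ (2 * t.totient + 1) := by ring
      _ ≤ a * p ^ (2 * t + 1) := by
          gcongr
          exact hp.out.one_le
      _ ≤ a * C := by gcongr
  refine absurd (hno _ hab hbound) (not_le.mpr ?_)
  refine vab_lt_of_block (p := p) (k := k) (g := 1) (w := J₀) ?_ ha hlt.le rfl hab ?_ ?_ ?_
    (one_dvd _) hJp
  · have := Nat.mul_pos hφ (Nat.pos_of_ne_zero hl0)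
    omega
  · rw [one_mul]
    exact Nat.not_dvd_of_pos_of_lt hJ1 hJp
  · rw [one_mul, hreq _ hJ1]
    exact not_intCast_dvd_of_natAbs_le hJr (hM _ (Nat.mul_pos (hpos _) hJ1)) hMp
  · rw [one_mul]
    have : psum (fun j => r (p ^ k * j)) 1 J₀ = psum (fun j => r (p ^ κ * j)) 1 J₀ := by
      refine Finset.sum_congr rfl fun j hj => ?_
      simp only [hreq j (Finset.mem_Icc.mp hj).1]
    rw [this]
    exact not_lt.mp hcon

lemma dvd_den_psum_of_block {p a K N : ℕ} [hp : Fact p.Prime] (ha : 1 ≤ a) (hK : K ≠ 0)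
    (haK : a ≤ p ^ K)
    (h : (p : ℚ)⁻¹ < padicNorm p (psum (fun j => r (p ^ K * j)) 1 (N / p ^ K))) :
    p ∣ (psum r a N).den := by
  have hp0 : (0 : ℚ) < p := by exact_mod_cast hp.out.pos
  have h1 := padicNorm_psum_sub_block_le (r := r) N ha haK
  have h2 : (p : ℚ) ^ ((K : ℤ) - 1) <
      padicNorm p (((p : ℚ) ^ K)⁻¹ * psum (fun j => r (p ^ K * j)) 1 (N / p ^ K)) := by
    rw [padicNorm.mul, padicNorm_pow_inv, zpow_sub₀ hp0.ne', zpow_natCast, zpow_one,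
      div_eq_mul_inv]
    gcongr
  refine (dvd_pow_self p hK).trans (pow_dvd_den_of_lt_padicNorm ?_)
  by_contra hcon
  have h3 := padicNorm.sub (p := p) (q := psum r a N)
    (r := psum r a N - ((p : ℚ) ^ K)⁻¹ * psum (fun j => r (p ^ K * j)) 1 (N / p ^ K))
  rw [sub_sub_cancel] at h3
  exact absurd (h3.trans (max_le (not_lt.mp hcon) h1)) (not_le.mpr h2)

/-- If `x` times the powers of `y` always has a small leading digit in base `q`, then `y` is
so close to a power of `q` that it must be one. -/
lemma exists_leading_digit {q y x D : ℕ} (hD : 1 < D) (hq : D * D < q) (hy : 1 ≤ y)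
    (hyq : ∀ d, y ≠ q ^ d) (hx : 1 ≤ x) :
    ∃ s, s ≤ D * D * y ∧ ∃ K, D * q ^ K ≤ x * y ^ s ∧ x * y ^ s < q ^ (K + 1) := by
  by_contra! hcon
  have hq1 : 1 < q := by nlinarith
  have hq0 : 0 < q := by omega
  have hxy : ∀ s, x * y ^ s ≠ 0 := fun s => (Nat.mul_pos hx (pow_pos hy s)).ne'
  set K : ℕ → ℕ := fun s => Nat.log q (x * y ^ s) with hK
  have hlow : ∀ s, q ^ K s ≤ x * y ^ s := fun s => Nat.pow_log_le_self q (hxy s)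
  have hup : ∀ s, s ≤ D * D * y → x * y ^ s < D * q ^ K s := by
    intro s hs
    by_contra h
    exact absurd (Nat.lt_pow_succ_log_self hq1 (x * y ^ s)) (not_lt.mpr (hcon s hs _ (not_lt.mp h)))
  have hmono : ∀ s, K s ≤ K (s + 1) := fun s => Nat.log_mono_right (by
    rw [pow_succ]
    exact Nat.mul_le_mul_left _ (Nat.le_mul_of_pos_right _ hy))
  -- the exponent increments satisfy `q ^ d < D * y` and `y < D * q ^ d`
  have hd : ∀ s, s + 1 ≤ D * D * y →
      q ^ (K (s + 1) - K s) < D * y ∧ y < D * q ^ (K (s + 1) - K s) := by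
    intro s hs
    obtain ⟨d, hd⟩ : ∃ d, K (s + 1) = K s + d := ⟨K (s + 1) - K s, by have := hmono s; omega⟩
    rw [hd, Nat.add_sub_cancel_left]
    have h1 := hlow (s + 1)
    have h2 := hup (s + 1) hs
    have h3 := hlow s
    have h4 := hup s (by omega)
    rw [hd, pow_add q, pow_succ y, ← mul_assoc] at h1 h2
    have hqK : 0 < q ^ K s := pow_pos hq0 _
    constructor
    · refine Nat.lt_of_mul_lt_mul_left (a := q ^ K s) ?_
      calc q ^ K s * q ^ d ≤ x * y ^ s * y := h1
        _ < D * q ^ K s * y := by gcongr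
        _ = q ^ K s * (D * y) := by ring
    · refine Nat.lt_of_mul_lt_mul_left (a := q ^ K s) ?_
      calc q ^ K s * y ≤ x * y ^ s * y := by gcongr
        _ < _ := h2
        _ = q ^ K s * (D * q ^ d) := by ring
  have huniq : ∀ d e, q ^ d < D * y → y < D * q ^ e → d ≤ e := by
    intro d e h1 h2
    by_contra h
    have h3 : q ^ e * q ≤ q ^ d := by
      rw [← pow_succ]
      exact Nat.pow_le_pow_right hq0 (by omega)
    have h4 : q ^ e * (D * D) < q ^ e * q := by
      have := pow_pos hq0 e
      gcongr
    nlinarith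
  have hS : 1 ≤ D * D * y := Nat.mul_pos (Nat.mul_pos (by omega) (by omega)) hy
  set d := K 1 - K 0 with hd0
  have hd1 := hd 0 hS
  have hKs : ∀ s, s ≤ D * D * y → K s = K 0 + d * s := by
    intro s
    induction s with
    | zero => simp
    | succ s ih =>
      intro hs
      have h1 := ih (by omega)
      have h2 := hd s hs
      have h3 := huniq _ _ h2.1 hd1.2
      have h4 := huniq _ _ hd1.1 h2.2
      have h5 := hmono s
      simp only [zero_add, ← hd0] at h3 h4
      rw [Nat.mul_succ]
      omega
  have hlow' := hlow (D * D * y)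
  have hup' := hup _ le_rfl
  rw [hKs _ le_rfl, pow_add q, pow_mul q] at hlow' hup'
  have hl0 := hlow 0
  have hu0 := hup 0 (by omega)
  simp only [pow_zero, mul_one] at hl0 hu0
  have hqd : 0 < q ^ d := pow_pos hq0 d
  have hqK : 0 < q ^ K 0 := pow_pos hq0 _
  simp only [zero_add, ← hd0] at hd1
  have bern : ∀ z n : ℕ, z ^ n * (z + n) ≤ (z + 1) ^ n * z := by
    intro z n
    induction n with
    | zero => simp
    | succ n ih =>
      calc z ^ (n + 1) * (z + (n + 1)) = z ^ n * (z + n) * z + z ^ n * z := by ring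
        _ ≤ (z + 1) ^ n * z * z + (z + 1) ^ n * z := by
          gcongr
          omega
        _ = (z + 1) ^ (n + 1) * z := by ring
  rcases lt_or_gt_of_ne (hyq d) with h | h
  · -- `y < q ^ d`
    have h1 : y ^ (D * D * y) * (y + D * D * y) ≤ (q ^ d) ^ (D * D * y) * y :=
      (bern y _).trans (by gcongr; exact h)
    have h2 : y ^ (D * D * y) * (1 + D * D) ≤ (q ^ d) ^ (D * D * y) := by
      refine le_of_mul_le_mul_right ?_ hy
      calc _ = y ^ (D * D * y) * (y + D * D * y) := by ring
        _ ≤ _ := h1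
    have h3 : q ^ K 0 * (y ^ (D * D * y) * (1 + D * D)) ≤ x * y ^ (D * D * y) :=
      (Nat.mul_le_mul_left _ h2).trans hlow'
    have h4 : 0 < y ^ (D * D * y) := pow_pos hy _
    have h5 : q ^ K 0 * (1 + D * D) ≤ x := by
      refine le_of_mul_le_mul_right ?_ h4
      calc _ = q ^ K 0 * (y ^ (D * D * y) * (1 + D * D)) := by ring
        _ ≤ _ := h3
    nlinarith
  · -- `q ^ d < y`
    have h1 : (q ^ d) ^ (D * D * y) * (q ^ d + D * D * y) ≤ y ^ (D * D * y) * q ^ d :=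
      (bern (q ^ d) _).trans (by gcongr; exact h)
    have h2 : (q ^ d) ^ (D * D * y) * (1 + D) ≤ y ^ (D * D * y) := by
      refine le_of_mul_le_mul_right ?_ hqd
      calc _ = (q ^ d) ^ (D * D * y) * (q ^ d + D * q ^ d) := by ring
        _ ≤ (q ^ d) ^ (D * D * y) * (q ^ d + D * D * y) := by
          gcongr
          nlinarith
        _ ≤ _ := h1
    have h3 : q ^ K 0 * ((q ^ d) ^ (D * D * y) * (1 + D)) <
        D * (q ^ K 0 * (q ^ d) ^ (D * D * y)) := by
      calc _ ≤ x * y ^ (D * D * y) := Nat.mul_le_mul hl0 h2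
        _ < _ := hup'
    have h4 : 0 < q ^ K 0 * (q ^ d) ^ (D * D * y) := Nat.mul_pos hqK (pow_pos hqd _)
    nlinarith

end noDrop

lemma inv_lt_padicNorm_psum_mul_of_noDrop {t : ℕ} {r : ℕ → ℤ} {M C a p q w : ℕ} (ht : 1 ≤ t)
    (hper : ∀ i, 1 ≤ i → r (i + t) = r i) (hnz : ∃ i, 1 ≤ i ∧ r i ≠ 0)
    (hM : ∀ i, 1 ≤ i → (r i).natAbs ≤ M) (htM : t ≤ M)
    (ha : 1 ≤ a) (hno : ∀ b, a < b → b ≤ a * C → vab r a (b - 1) ≤ vab r a b)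
    [hp : Fact p.Prime] [hq : Fact q.Prime] (hpq : p ≠ q) (hMp : M < p) (hMq : M < q)
    (htq : (t + 1) * (t + 1) < q) (hw : 1 ≤ w) (hwt : w ≤ t) (hr : r (q * w) ≠ 0)
    (hCp : (p ^ t) ^ (1 + (t + 1) * (t + 1) * p ^ t) * (q * w) ≤ C)
    (hCq : q ^ (2 * t + 1) ≤ C) :
    (p : ℚ)⁻¹ < padicNorm p (psum r 1 (q * w)) := by
  by_contra hcon
  have hp1 := hp.out.one_lt
  have hq1 := hq.out.one_lt
  have hφ : 1 ≤ t.totient := Nat.totient_pos.mpr ht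
  have hφt : t.totient ≤ t := Nat.totient_le t
  have hcop : ∀ ℓ : ℕ, ℓ.Prime → M < ℓ → ℓ.Coprime t := fun ℓ hℓ h =>
    (Nat.Prime.coprime_iff_not_dvd hℓ).mpr fun h' => by
      have := Nat.le_of_dvd ht h'
      omega
  have hpcop : p.Coprime q := (Nat.coprime_primes hp.out hq.out).mpr hpq
  set y := p ^ t.totient with hy
  have hy1 : 1 < y := Nat.one_lt_pow (by omega) hp1
  have hyq : ∀ d, y ≠ q ^ d := by
    intro d h
    have h1 : p ∣ q ^ d := h ▸ dvd_pow_self p (by omega)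
    exact hpq ((Nat.prime_dvd_prime_iff_eq hp.out hq.out).mp (hp.out.dvd_of_dvd_pow h1))
  obtain ⟨l, hl0, hal, hla⟩ := exists_lt_pow_le_mul (y := y) (a := a) hy1 ha
  have hqw : 1 ≤ q * w := Nat.mul_pos hq.out.pos hw
  obtain ⟨s, hs, K, hK1, hK2⟩ := exists_leading_digit (q := q) (y := y) (D := t + 1)
    (x := y ^ l * (q * w)) (by omega) htq hy1.le hyq
    (Nat.mul_pos (pow_pos (by omega) _) hqw)
  set k := t.totient * (l + s) with hk
  set b := p ^ k * (q * w) with hb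
  have hpk : p ^ k = y ^ l * y ^ s := by rw [hk, pow_mul, pow_add]
  have hbx : y ^ l * (q * w) * y ^ s = b := by rw [hb, hpk]; ring
  rw [hbx] at hK1 hK2
  have hys : 1 ≤ y ^ s := Nat.one_le_pow _ _ (by omega)
  have hlt : a < p ^ k := hpk ▸ hal.trans_le (Nat.le_mul_of_pos_right _ hys)
  have hpkb : p ^ k * q ≤ b := Nat.mul_le_mul_left _ (Nat.le_mul_of_pos_right _ hw)
  have hab : a < b := hlt.trans_le (Nat.le_mul_of_pos_right _ hqw)
  have haK : a < q ^ K := by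
    refine Nat.lt_of_mul_lt_mul_right (a := q) ?_
    calc a * q ≤ p ^ k * q := by gcongr
      _ < q ^ K * q := by rw [← pow_succ]; omega
  have hbound : b ≤ a * C := by
    calc b = y ^ l * y ^ s * (q * w) := by rw [hb, hpk]
      _ ≤ (a * y) * y ^ ((t + 1) * (t + 1) * y) * (q * w) := by
          gcongr
          omega
      _ = a * (y ^ (1 + (t + 1) * (t + 1) * y) * (q * w)) := by ring
      _ ≤ a * ((p ^ t) ^ (1 + (t + 1) * (t + 1) * p ^ t) * (q * w)) := by
          have hyt : y ≤ p ^ t := Nat.pow_le_pow_right hp.out.pos hφt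
          have h0 : 0 < p ^ t := pow_pos hp.out.pos t
          gcongr
      _ ≤ a * C := by gcongr
  have hqK : 0 < q ^ K := pow_pos hq.out.pos K
  have hK0 : K ≠ 0 := by
    rintro rfl
    simp at haK
    omega
  have hg : q ∣ vab r a (b - 1) := by
    rw [vab_eq_den_psum r _ ha]
    refine dvd_den_psum_of_block ha hK0 haK.le ?_
    have hJt : t ≤ (b - 1) / q ^ K := by
      rw [Nat.le_div_iff_mul_le hqK]
      have : (t + 1) * q ^ K = t * q ^ K + q ^ K := by ring
      omega
    obtain ⟨j, hj1, hj2, hj3⟩ := exists_mul_apply_ne_zero ht hper hnz (u := q ^ K) hqK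
      (Nat.Coprime.pow_left K (hcop q hq.out hMq))
    refine inv_lt_padicNorm_psum_of_noDrop ht hper hM htM ha hno hMq ?_ hCq
      ⟨j, hj1, hj2.trans hJt, hj3⟩
    rw [Nat.div_lt_iff_lt_mul hqK, ← pow_succ']
    omega
  have hmod : p ^ k ≡ 1 [MOD t] := by
    rw [hk, pow_mul]
    simpa using (Nat.ModEq.pow_totient (hcop p hp.out hMp)).pow (l + s)
  have hpos : 1 ≤ p ^ k := by omega
  have hreq : ∀ j, 1 ≤ j → r (p ^ k * j) = r j := fun j hj =>
    eq_of_modEq_of_periodic hper (Nat.mul_pos hpos hj) hj (by simpa using hmod.mul_right j)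
  refine absurd (hno _ hab hbound) (not_le.mpr ?_)
  refine vab_lt_of_block (p := p) (k := k) (g := q) (w := w) ?_ ha hlt.le hb hab ?_ ?_ ?_ hg
    (by omega)
  · have := Nat.mul_pos hφ (by omega : 0 < l + s)
    omega
  · rw [hp.out.dvd_mul, not_or]
    exact ⟨(Nat.Prime.coprime_iff_not_dvd hp.out).mp hpcop,
      Nat.not_dvd_of_pos_of_lt hw (by omega)⟩
  · rw [hb, hreq _ hqw]
    exact not_intCast_dvd_of_natAbs_le hr (hM _ hqw) hMp
  · have : psum (fun j => r (p ^ k * j)) 1 (q * w) = psum r 1 (q * w) := by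
      refine Finset.sum_congr rfl fun j hj => ?_
      simp only [hreq j (Finset.mem_Icc.mp hj).1]
    rw [this]
    exact not_lt.mp hcon

lemma le_pow_of_smooth {n M Z : ℕ} (hn : n ≠ 0) (hZ : 1 ≤ Z)
    (hsm : ∀ p, p.Prime → p ∣ n → p ≤ M) (hpow : ∀ p, p.Prime → p ^ n.factorization p ≤ Z) :
    n ≤ Z ^ M := by
  have hsub : n.factorization.support ⊆ Finset.Icc 1 M := by
    intro p hp
    rw [Nat.support_factorization, Nat.mem_primeFactors] at hp
    exact Finset.mem_Icc.mpr ⟨hp.1.one_le, hsm p hp.1 hp.2.1⟩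
  calc n = ∏ p ∈ n.factorization.support, p ^ n.factorization p :=
        (Nat.prod_factorization_pow_eq_self hn).symm
    _ ≤ Z ^ n.factorization.support.card := by
        refine Finset.prod_le_pow_card _ _ _ fun p hp => hpow p ?_
        rw [Nat.support_factorization] at hp
        exact Nat.prime_of_mem_primeFactors hp
    _ ≤ Z ^ M := by
        refine Nat.pow_le_pow_right hZ ?_
        simpa using Finset.card_le_card hsub

lemma small_or_pow_dvd_num {x : ℚ} {M Z : ℕ} (hx : x ≠ 0) (hZ : 1 ≤ Z)
    (hsm : ∀ p : ℕ, p.Prime → M < p → ¬ (p : ℤ) ∣ x.num) (hden : Z ^ (M + 1) < x.den) :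
    |x| * Z < 1 ∨ ∃ p ∈ Finset.Icc 1 M, p.Prime ∧ ((p ^ (Nat.log p Z + 1) : ℕ) : ℤ) ∣ x.num := by
  by_contra! hcon
  obtain ⟨h1, h2⟩ := hcon
  have hnum : x.num.natAbs ≠ 0 := by simpa using hx
  have hsm' : ∀ p : ℕ, p.Prime → p ∣ x.num.natAbs → p ≤ M := fun p hp hd => by
    by_contra h
    exact hsm p hp (not_le.mp h) (Int.natCast_dvd.mpr hd)
  have hle : x.num.natAbs ≤ Z ^ M := by
    refine le_pow_of_smooth hnum hZ hsm' fun p hp => ?_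
    by_contra hlt
    have hlt := not_le.mp hlt
    have hdvd : p ^ x.num.natAbs.factorization p ∣ x.num.natAbs := Nat.ordProj_dvd _ _
    have hlog : Nat.log p Z + 1 ≤ x.num.natAbs.factorization p :=
      Nat.log_lt_of_lt_pow (by omega) hlt
    have hp1 : p ∣ x.num.natAbs :=
      (dvd_pow_self p (by omega : x.num.natAbs.factorization p ≠ 0)).trans hdvd
    exact h2 p (Finset.mem_Icc.mpr ⟨hp.one_le, hsm' p hp hp1⟩) hp
      (Int.natCast_dvd.mpr ((pow_dvd_pow p hlog).trans hdvd))
  have hxabs : |x| = (x.num.natAbs : ℚ) / x.den := by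
    rw [Nat.cast_natAbs, Int.cast_abs]
    conv_lhs => rw [← Rat.num_div_den x]
    rw [abs_div, Nat.abs_cast]
  have hd0 : (0 : ℚ) < x.den := by exact_mod_cast x.den_pos
  rw [hxabs, div_mul_eq_mul_div, le_div_iff₀ hd0, one_mul] at h1
  have h3 : x.den ≤ x.num.natAbs * Z := by exact_mod_cast h1
  have h4 : x.num.natAbs * Z ≤ Z ^ (M + 1) := by
    rw [pow_succ]
    exact Nat.mul_le_mul_right _ hle
  omega

lemma psum_sub_psum (r : ℕ → ℤ) {n n' : ℕ} (h : n ≤ n') :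
    psum r 1 n' - psum r 1 n = ∑ i ∈ Finset.Ioc n n', (r i : ℚ) / i := by
  have h1 : ∀ k, Finset.Icc 1 k = Finset.Ioc 0 k := fun k => rfl
  rw [psum, psum, h1, h1, ← Finset.sum_Ioc_consecutive _ (Nat.zero_le n) h]
  ring

lemma exists_int_eq_sum_mul_prod (r : ℕ → ℤ) (n n' : ℕ) :
    ∃ A : ℤ, (∑ i ∈ Finset.Ioc n n', (r i : ℚ) / i) * ((∏ i ∈ Finset.Ioc n n', i : ℕ) : ℚ) = A := by
  refine ⟨∑ i ∈ Finset.Ioc n n', r i * (∏ j ∈ (Finset.Ioc n n').erase i, j : ℕ), ?_⟩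
  rw [Finset.sum_mul]
  push_cast
  refine Finset.sum_congr rfl fun i hi => ?_
  have hi0 : (i : ℚ) ≠ 0 := by
    have := (Finset.mem_Ioc.mp hi).1
    exact_mod_cast (by omega : i ≠ 0)
  rw [← Finset.mul_prod_erase _ _ hi]
  field_simp

lemma abs_sum_Ioc_le {r : ℕ → ℤ} {M n n' : ℕ} (hM : ∀ i, 1 ≤ i → (r i).natAbs ≤ M) :
    |∑ i ∈ Finset.Ioc n n', (r i : ℚ) / i| ≤ ((n' - n : ℕ) : ℚ) * M := by
  refine (Finset.abs_sum_le_sum_abs _ _).trans ?_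
  refine (Finset.sum_le_card_nsmul _ _ (M : ℚ) fun i hi => ?_).trans ?_
  · have hi1 : 1 ≤ i := by
      have := (Finset.mem_Ioc.mp hi).1
      omega
    rw [abs_div, Nat.abs_cast]
    have h1 : |(r i : ℚ)| ≤ M := by
      rw [← Int.cast_abs, Int.abs_eq_natAbs]
      exact_mod_cast hM i hi1
    exact (div_le_self (abs_nonneg _) (by exact_mod_cast hi1)).trans h1
  · simp

lemma sum_Ioc_ne_zero {r : ℕ → ℤ} {M n q w : ℕ} [hq : Fact q.Prime]
    (hM : ∀ i, 1 ≤ i → (r i).natAbs ≤ M) (hMq : M < q) (hr : r (q * w) ≠ 0)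
    (hw : 1 ≤ w) (hn : n < q * w) (hnq : q * w < n + q) :
    ∑ i ∈ Finset.Ioc n (q * w), (r i : ℚ) / i ≠ 0 := by
  have hqw : 1 ≤ q * w := Nat.mul_pos hq.out.pos hw
  intro h
  rw [← Finset.add_sum_erase _ _ (Finset.mem_Ioc.mpr ⟨hn, le_refl _⟩)] at h
  have h1 : padicNorm q (∑ i ∈ (Finset.Ioc n (q * w)).erase (q * w), (r i : ℚ) / i) ≤ 1 := by
    refine padicNorm.sum_le' (fun i hi => ?_) zero_le_one
    simp only [Finset.mem_erase, Finset.mem_Ioc] at hi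
    have := padicNorm_int_div_nat_le (p := q) (z := r i) (i := i) (k := 1) (by
      rw [pow_one]
      intro hd
      have h2 : q ∣ q * w - i := Nat.dvd_sub (dvd_mul_right q w) hd
      have := Nat.le_of_dvd (by omega) h2
      omega)
    simpa using this
  rw [← neg_eq_iff_add_eq_zero] at h
  rw [← h, padicNorm.neg, padicNorm.div] at h1
  have h2 : padicNorm q (r (q * w) : ℚ) = 1 :=
    (padicNorm.int_eq_one_iff _).mpr (not_intCast_dvd_of_natAbs_le hr (hM _ hqw) hMq)
  have h3 : padicNorm q ((q * w : ℕ) : ℚ) < 1 :=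
    (padicNorm.nat_lt_one_iff _).mpr (dvd_mul_right q w)
  have h4 : 0 < padicNorm q ((q * w : ℕ) : ℚ) := padicNorm_natCast_pos (by omega)
  rw [h2, div_le_one h4] at h1
  exact absurd h1 (not_le.mpr h3)

section twoSums
variable {r : ℕ → ℤ} {M n n' h N : ℕ}

lemma prod_Ioc_le_pow (hN : 1 ≤ N) (hh : n' - n ≤ h) (hn' : n' ≤ N) :
    ∏ i ∈ Finset.Ioc n n', i ≤ N ^ h := by
  refine (Finset.prod_le_pow_card _ _ N fun i hi => ?_).trans ?_
  · exact (Finset.mem_Ioc.mp hi).2.trans hn'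
  · exact Nat.pow_le_pow_right hN (by simpa using hh)

lemma prod_Ioc_pos : 0 < ∏ i ∈ Finset.Ioc n n', i :=
  Finset.prod_pos fun i hi => by
    have := (Finset.mem_Ioc.mp hi).1
    omega

lemma one_le_abs_sum_Ioc_mul (hN : 1 ≤ N) (hh : n' - n ≤ h) (hn' : n' ≤ N)
    (hd : ∑ i ∈ Finset.Ioc n n', (r i : ℚ) / i ≠ 0) :
    1 ≤ |∑ i ∈ Finset.Ioc n n', (r i : ℚ) / i| * (N : ℚ) ^ h := by
  obtain ⟨A, hA⟩ := exists_int_eq_sum_mul_prod r n n'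
  have hy : (0 : ℚ) < ((∏ i ∈ Finset.Ioc n n', i : ℕ) : ℚ) := by exact_mod_cast prod_Ioc_pos
  have hA0 : A ≠ 0 := by
    rintro rfl
    rw [Int.cast_zero, mul_eq_zero] at hA
    exact hA.elim hd hy.ne'
  have h1 : (1 : ℚ) ≤ |(A : ℚ)| := by exact_mod_cast Int.one_le_abs hA0
  rw [← hA, abs_mul, abs_of_pos hy] at h1
  refine h1.trans (mul_le_mul_of_nonneg_left ?_ (abs_nonneg _))
  exact_mod_cast prod_Ioc_le_pow hN hh hn'

lemma pow_le_of_padicNorm_sum_Ioc_le {p k : ℕ} [hp : Fact p.Prime]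
    (hM : ∀ i, 1 ≤ i → (r i).natAbs ≤ M) (hN : 1 ≤ N) (hh : n' - n ≤ h) (hn' : n' ≤ N)
    (hd : ∑ i ∈ Finset.Ioc n n', (r i : ℚ) / i ≠ 0)
    (hk : padicNorm p (∑ i ∈ Finset.Ioc n n', (r i : ℚ) / i) ≤ ((p : ℚ) ^ k)⁻¹) :
    p ^ k ≤ h * M * N ^ h := by
  obtain ⟨A, hA⟩ := exists_int_eq_sum_mul_prod r n n'
  have hy : (0 : ℚ) < ((∏ i ∈ Finset.Ioc n n', i : ℕ) : ℚ) := by exact_mod_cast prod_Ioc_pos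
  have hA0 : A ≠ 0 := by
    rintro rfl
    rw [Int.cast_zero, mul_eq_zero] at hA
    exact hA.elim hd hy.ne'
  have hdvd : ((p ^ k : ℕ) : ℤ) ∣ A := by
    rw [padicNorm.dvd_iff_norm_le, ← hA, padicNorm.mul, zpow_neg, zpow_natCast]
    refine (mul_le_of_le_one_right (padicNorm.nonneg _) ?_).trans hk
    exact padicNorm.of_nat _
  have h1 : p ^ k ≤ A.natAbs := Nat.le_of_dvd (Int.natAbs_pos.mpr hA0) (Int.natCast_dvd.mp hdvd)
  refine h1.trans ?_
  have h2 : |(A : ℚ)| ≤ (h : ℚ) * M * (N : ℚ) ^ h := by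
    rw [← hA, abs_mul, abs_of_pos hy]
    have h3 : (((n' - n : ℕ) : ℚ)) ≤ h := by exact_mod_cast hh
    have h4 : ((∏ i ∈ Finset.Ioc n n', i : ℕ) : ℚ) ≤ (N : ℚ) ^ h := by
      exact_mod_cast prod_Ioc_le_pow hN hh hn'
    have h5 := (abs_sum_Ioc_le (n := n) (n' := n') hM).trans
      (mul_le_mul_of_nonneg_right h3 (Nat.cast_nonneg M))
    gcongr
  rw [← Int.cast_abs, Int.abs_eq_natAbs] at h2
  exact_mod_cast h2

end twoSums

/-- Among too many sums with large denominator and `M`-smooth numerator, two are either both very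
small or both divisible by a high power of the same prime; their difference cannot be. -/
lemma false_of_many_smooth_sums {r : ℕ → ℤ} {M w h N : ℕ} {Q : Finset ℕ}
    (hM : ∀ i, 1 ≤ i → (r i).natAbs ≤ M) (hM1 : 1 ≤ M) (hh : 1 ≤ h) (hN : 1 ≤ N) (hw : 1 ≤ w)
    (hcard : M + 1 < Q.card) (hprime : ∀ q ∈ Q, q.Prime) (hMq : ∀ q ∈ Q, M < q)
    (hr : ∀ q ∈ Q, r (q * w) ≠ 0) (hqN : ∀ q ∈ Q, q * w ≤ N)
    (hdist : ∀ q ∈ Q, ∀ q' ∈ Q, q < q' → q' * w ≤ q * w + h) (hhq : ∀ q ∈ Q, h < q)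
    (hne : ∀ q ∈ Q, psum r 1 (q * w) ≠ 0)
    (hsm : ∀ q ∈ Q, ∀ p : ℕ, p.Prime → M < p → ¬ (p : ℤ) ∣ (psum r 1 (q * w)).num)
    (hden : ∀ q ∈ Q, (2 * h * M * N ^ h) ^ (M + 1) < (psum r 1 (q * w)).den) : False := by
  set Z := 2 * h * M * N ^ h with hZdef
  have hNh : 1 ≤ N ^ h := Nat.one_le_pow _ _ hN
  have hhM : 1 ≤ h * M := Nat.mul_pos hh hM1
  have hZ2 : 2 * N ^ h ≤ Z := by
    rw [hZdef, mul_assoc 2 h M]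
    exact Nat.mul_le_mul_right _ (by omega)
  have hZ1 : h * M * N ^ h < Z := by
    have : Z = h * M * N ^ h + h * M * N ^ h := by rw [hZdef]; ring
    have := Nat.mul_pos hhM hNh
    omega
  -- `0` stands for a small sum, `p` for a numerator divisible by a high power of `p`
  let P : ℕ → ℕ → Prop := fun q c => if c = 0 then |psum r 1 (q * w)| * Z < 1 else
    c.Prime ∧ ((c ^ (Nat.log c Z + 1) : ℕ) : ℤ) ∣ (psum r 1 (q * w)).num
  have hex : ∀ q ∈ Q, ∃ c ∈ Finset.range (M + 1), P q c := by
    intro q hq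
    rcases small_or_pow_dvd_num (hne q hq) (by omega : 1 ≤ Z) (hsm q hq) (hden q hq) with
      h0 | ⟨p, hp, hpp, hd⟩
    · exact ⟨0, by simp, by simpa [P] using h0⟩
    · have hp' := Finset.mem_Icc.mp hp
      refine ⟨p, Finset.mem_range.mpr (by omega), ?_⟩
      simp only [P, if_neg hpp.ne_zero]
      exact ⟨hpp, hd⟩
  choose! f hf hfP using hex
  obtain ⟨q₁, hq₁, q₂, hq₂, hne12, heq⟩ := Finset.exists_ne_map_eq_of_card_lt_of_maps_to
    (s := Q) (t := Finset.range (M + 1)) (by simpa using hcard) (f := f) hf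
  wlog hlt : q₁ < q₂ generalizing q₁ q₂
  · exact this q₂ hq₂ q₁ hq₁ hne12.symm heq.symm (by omega)
  have hP1 := hfP q₁ hq₁
  have hP2 := hfP q₂ hq₂
  rw [heq] at hP1
  have hdiff := hdist q₁ hq₁ q₂ hq₂ hlt
  have hltw : q₁ * w < q₂ * w := Nat.mul_lt_mul_of_pos_right hlt hw
  have : Fact q₂.Prime := ⟨hprime q₂ hq₂⟩
  have hsub := psum_sub_psum r hltw.le
  have hh' : q₂ * w - q₁ * w ≤ h := by omega
  have hd0 := sum_Ioc_ne_zero (q := q₂) (w := w) (n := q₁ * w) hM (hMq q₂ hq₂) (hr q₂ hq₂) hw hltw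
    (by have := hhq q₂ hq₂; omega)
  by_cases hc : f q₂ = 0
  · simp only [P, if_pos hc] at hP1 hP2
    have h1 := one_le_abs_sum_Ioc_mul hN hh' (hqN q₂ hq₂) hd0
    rw [← hsub] at h1
    have h2 := abs_sub (psum r 1 (q₂ * w)) (psum r 1 (q₁ * w))
    have h3 : (2 : ℚ) * (N : ℚ) ^ h ≤ Z := by exact_mod_cast hZ2
    have h4 : (0 : ℚ) ≤ |psum r 1 (q₂ * w) - psum r 1 (q₁ * w)| := abs_nonneg _
    have h5 := mul_le_mul_of_nonneg_left h3 h4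
    have h6 := mul_le_mul_of_nonneg_right h2 (Nat.cast_nonneg (α := ℚ) Z)
    linarith
  · simp only [P, if_neg hc] at hP1 hP2
    have : Fact (f q₂).Prime := ⟨hP1.1⟩
    have h1 := padicNorm_le_of_pow_dvd_num (p := f q₂) (by omega) hP1.2
    have h2 := padicNorm_le_of_pow_dvd_num (p := f q₂) (by omega) hP2.2
    have h3 := (padicNorm.sub (p := f q₂) (q := psum r 1 (q₂ * w))
      (r := psum r 1 (q₁ * w))).trans (max_le h2 h1)
    rw [hsub] at h3
    have h4 := pow_le_of_padicNorm_sum_Ioc_le hM hN hh' (hqN q₂ hq₂) hd0 h3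
    exact absurd (Nat.lt_pow_succ_log_self hP1.1.one_lt Z) (not_lt.mpr (h4.trans hZ1.le))

section noDropOne
variable {t : ℕ} {r : ℕ → ℤ} {M C a : ℕ}

lemma dvd_den_psum_one_of_noDrop {p n : ℕ} (ht : 1 ≤ t)
    (hper : ∀ i, 1 ≤ i → r (i + t) = r i) (hnz : ∃ i, 1 ≤ i ∧ r i ≠ 0)
    (hM : ∀ i, 1 ≤ i → (r i).natAbs ≤ M) (htM : t ≤ M)
    (ha : 1 ≤ a) (hno : ∀ b, a < b → b ≤ a * C → vab r a (b - 1) ≤ vab r a b)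
    (hp : p.Prime) (hMp : M < p) (hpn : t * p ≤ n) (hnp : n < p * p)
    (hC : p ^ (2 * t + 1) ≤ C) : p ∣ (psum r 1 n).den := by
  have : Fact p.Prime := ⟨hp⟩
  have hcop : (p ^ 1).Coprime t := Nat.Coprime.pow_left 1
    ((Nat.Prime.coprime_iff_not_dvd hp).mpr fun h => by
      have := Nat.le_of_dvd ht h
      omega)
  obtain ⟨j, hj1, hj2, hj3⟩ := exists_mul_apply_ne_zero ht hper hnz (u := p ^ 1)
    (pow_pos hp.pos 1) hcop
  refine dvd_den_psum_of_block (K := 1) le_rfl one_ne_zero (by simpa using hp.one_le) ?_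
  refine inv_lt_padicNorm_psum_of_noDrop ht hper hM htM ha hno hMp ?_ hC ⟨j, hj1, ?_, hj3⟩
  · rw [pow_one]
    exact Nat.div_lt_of_lt_mul hnp
  · rw [pow_one]
    exact hj2.trans ((Nat.le_div_iff_mul_le hp.pos).mpr hpn)

lemma psum_smooth_of_noDrop {q w Y : ℕ} (ht : 1 ≤ t)
    (hper : ∀ i, 1 ≤ i → r (i + t) = r i) (hnz : ∃ i, 1 ≤ i ∧ r i ≠ 0)
    (hM : ∀ i, 1 ≤ i → (r i).natAbs ≤ M) (htM : t ≤ M)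
    (ha : 1 ≤ a) (hno : ∀ b, a < b → b ≤ a * C → vab r a (b - 1) ≤ vab r a b)
    (hq : q.Prime) (hMq : M < q) (htq : (t + 1) * (t + 1) < q) (hw : 1 ≤ w) (hwt : w ≤ t)
    (hr : r (q * w) ≠ 0) (hY : q * w ≤ Y)
    (hC₁ : (Y ^ t) ^ (1 + (t + 1) * (t + 1) * Y ^ t) * Y ≤ C)
    (hC₂ : (Y ^ (Y + 2)) ^ (2 * t + 1) ≤ C) :
    psum r 1 (q * w) ≠ 0 ∧
      ∀ p : ℕ, p.Prime → M < p → ¬ (p : ℤ) ∣ (psum r 1 (q * w)).num := by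
  have : Fact q.Prime := ⟨hq⟩
  have hqw : q ≤ q * w := Nat.le_mul_of_pos_right _ hw
  have hY1 : 1 ≤ Y := by have := hq.one_le; omega
  have hYpow : ∀ p, p ≤ Y ^ (Y + 2) → p ^ (2 * t + 1) ≤ C := fun p hp =>
    (Nat.pow_le_pow_left hp _).trans hC₂
  have hYle : Y ≤ Y ^ (Y + 2) := Nat.le_self_pow (by omega) Y
  have hqden : q ∣ (psum r 1 (q * w)).den := by
    refine dvd_den_psum_of_block (K := 1) le_rfl one_ne_zero (by simpa using hq.one_le) ?_
    rw [pow_one, Nat.mul_div_cancel_left w hq.pos]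
    simpa using inv_lt_padicNorm_psum_of_noDrop (κ := 1) (J := w) ht hper hM htM ha hno hMq
      (by omega) (hYpow q (by omega)) ⟨w, hw, le_rfl, by simpa using hr⟩
  have hne : psum r 1 (q * w) ≠ 0 := by
    intro h
    rw [h, Rat.den_zero] at hqden
    exact hq.one_lt.ne' (Nat.dvd_one.mp hqden)
  refine ⟨hne, fun p hp hMp hdvd => ?_⟩
  have : Fact p.Prime := ⟨hp⟩
  have hle := padicNorm_le_of_pow_dvd_num (p := p) (k := 1) one_ne_zero (by simpa using hdvd)
  rw [pow_one] at hle
  have heq : psum r 1 (q * w) = ∑ i ∈ Finset.Ioc 0 (q * w), (r i : ℚ) / i := rfl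
  have hpY : p ≤ Y ^ (Y + 2) := by
    have h1 := pow_le_of_padicNorm_sum_Ioc_le (p := p) (k := 1) (n := 0) (n' := q * w) (h := Y)
      (N := Y) hM hY1 (by omega) hY (heq ▸ hne) (by rw [pow_one]; exact heq ▸ hle)
    calc p = p ^ 1 := (pow_one p).symm
      _ ≤ Y * M * Y ^ Y := h1
      _ ≤ Y * Y * Y ^ Y := by
          gcongr
          omega
      _ = Y ^ (Y + 2) := by ring
  refine absurd hle (not_le.mpr ?_)
  rcases eq_or_ne p q with rfl | hpq
  · have h1 := padicNorm_num_eq_one hqden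
    rw [padicNorm.int_eq_one_iff] at h1
    exact absurd hdvd h1
  rcases lt_or_ge (q * w) p with hlt | hge
  · simpa using inv_lt_padicNorm_psum_of_noDrop (κ := 0) ht hper hM htM ha hno hMp hlt
      (hYpow p hpY) ⟨q * w, by have := hq.one_le; omega, le_rfl, by simpa using hr⟩
  · refine inv_lt_padicNorm_psum_mul_of_noDrop ht hper hnz hM htM ha hno hpq hMp hMq htq hw hwt hr
      (le_trans ?_ hC₁) (hYpow q (by omega))
    have hpY' : p ≤ Y := hge.trans hY
    have h1 : p ^ t ≤ Y ^ t := Nat.pow_le_pow_left hpY' t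
    have h2 : 0 < Y ^ t := pow_pos hY1 t
    gcongr

end noDropOne

lemma primeCounting_le_card_add (x y : ℕ) :
    y.primeCounting ≤ ((Finset.Ioc x y).filter Nat.Prime).card + x := by
  have h1 : ((Finset.Icc 1 y).filter Nat.Prime).card = y.primeCounting := by
    rw [Nat.primeCounting, Nat.primeCounting', Nat.count_eq_card_filter_range]
    congr 1
    ext p
    simp only [Finset.mem_filter, Finset.mem_Icc, Finset.mem_range]
    constructor
    · rintro ⟨h, hp⟩
      exact ⟨by omega, hp⟩
    · rintro ⟨h, hp⟩
      exact ⟨⟨hp.one_le, by omega⟩, hp⟩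
  have h2 : (Finset.Icc 1 y).filter Nat.Prime ⊆
      (Finset.Ioc x y).filter Nat.Prime ∪ Finset.Icc 1 x := by
    intro p
    simp only [Finset.mem_filter, Finset.mem_Icc, Finset.mem_union, Finset.mem_Ioc]
    rintro ⟨⟨h3, h4⟩, hp⟩
    by_cases h : x < p
    · exact Or.inl ⟨⟨h, h4⟩, hp⟩
    · exact Or.inr ⟨h3, by omega⟩
  have h3 := (Finset.card_le_card h2).trans (Finset.card_union_le _ _)
  simp only [Nat.card_Icc] at h3
  omega

lemma two_pow_le_of_primes_dvd {n x y k : ℕ} (hn : n ≠ 0) (hk : k + x ≤ y.primeCounting)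
    (hdvd : ∀ p, p.Prime → x < p → p ≤ y → p ∣ n) : 2 ^ k ≤ n := by
  set S := (Finset.Ioc x y).filter Nat.Prime with hS
  have hcard : k ≤ S.card := by
    have := primeCounting_le_card_add x y
    rw [← hS] at this
    omega
  have hprod : ∏ p ∈ S, p ∣ n := by
    refine Finset.prod_primes_dvd n (fun p hp => ?_) fun p hp => ?_
    · exact (Finset.mem_filter.mp hp).2.prime
    · simp only [hS, Finset.mem_filter, Finset.mem_Ioc] at hp
      exact hdvd p hp.2 hp.1.1 hp.1.2
  calc 2 ^ k ≤ 2 ^ S.card := Nat.pow_le_pow_right (by norm_num) hcard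
    _ ≤ ∏ p ∈ S, p := Finset.pow_card_le_prod _ _ _ fun p hp =>
        (Finset.mem_filter.mp hp).2.two_le
    _ ≤ n := Nat.le_of_dvd (Nat.pos_of_ne_zero hn) hprod

/-- A weak Chebyshev bound at powers of two. -/
lemma two_pow_le_primeCounting {x : ℕ} (hx : 1 ≤ x) :
    2 ^ x ≤ x * (2 ^ x).primeCounting + x + 1 := by
  have h1 := Chebyshev.pi_ge (2 ^ x)
  have hl : 0 < Real.log 2 := Real.log_pos one_lt_two
  have hx0 : (0 : ℝ) < x := by exact_mod_cast hx
  have h2 : Real.log ((2 : ℝ) ^ x + 1) ≤ (x + 1) * Real.log 2 := by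
    have h3 : (2 : ℝ) ^ x + 1 ≤ 2 ^ (x + 1) := by
      have : (1 : ℝ) ≤ 2 ^ x := one_le_pow₀ one_le_two
      rw [pow_succ]
      linarith
    refine (Real.log_le_log (by positivity) h3).trans_eq ?_
    rw [Real.log_pow]
    push_cast
    ring
  push_cast at h1
  rw [Real.log_pow, div_le_iff₀ (by positivity)] at h1
  have h4 : (2 : ℝ) ^ x * Real.log 2 ≤
      (x * (2 ^ x).primeCounting + x + 1) * Real.log 2 := by linarith
  exact_mod_cast le_of_mul_le_mul_right h4 hl

lemma exists_close_primes {m t : ℕ} (hm : 2 ≤ m) (ht : 1 ≤ t) (htm : t ≤ m) :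
    ∃ Q : Finset ℕ, m < Q.card ∧
      (∀ q ∈ Q, q.Prime ∧ 2 ^ (30 * m) < q ∧ q ≤ 2 ^ (40 * m)) ∧
      ∀ q ∈ Q, ∀ q' ∈ Q, q ≡ q' [MOD t] ∧ q' ≤ q + 640 * m ^ 3 := by
  set δ := 640 * m ^ 3 with hδ
  set u := 2 ^ m with hu
  have hum : m ≤ u := Nat.lt_two_pow_self.le
  have hu4 : 4 ≤ u := by
    calc 4 = 2 ^ 2 := rfl
      _ ≤ 2 ^ m := Nat.pow_le_pow_right (by norm_num) hm
  have hp : ∀ k, 2 ^ (k * m) = u ^ k := fun k => by rw [mul_comm, pow_mul]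
  have hδ0 : 0 < δ := by positivity
  set P := (Finset.Ioc (2 ^ (30 * m)) (2 ^ (40 * m))).filter Nat.Prime with hP
  set T := Finset.range t ×ˢ Finset.range (2 ^ (40 * m) / δ + 1) with hT
  have hmaps : ∀ q ∈ P, (q % t, q / δ) ∈ T := by
    intro q hq
    simp only [hP, Finset.mem_filter, Finset.mem_Ioc] at hq
    simp only [hT, Finset.mem_product, Finset.mem_range]
    exact ⟨Nat.mod_lt _ ht, Nat.lt_succ_of_le (Nat.div_le_div_right hq.1.2)⟩
  have hcard : T.card * m < P.card := by
    by_contra! hcon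
    rw [hT, Finset.card_product, Finset.card_range, Finset.card_range] at hcon
    have h1 := primeCounting_le_card_add (2 ^ (30 * m)) (2 ^ (40 * m))
    have h2 := two_pow_le_primeCounting (x := 40 * m) (by omega)
    have h3 : 2 ^ (40 * m) / δ * δ ≤ 2 ^ (40 * m) := Nat.div_mul_le_self _ _
    rw [← hP] at h1
    rw [hp 40] at *
    rw [hp 30] at h1
    set D := u ^ 40 / δ with hD
    set π := (u ^ 40).primeCounting with hπ
    have h4 : π ≤ m ^ 2 * (D + 1) + u ^ 30 := by
      calc π ≤ t * (D + 1) * m + u ^ 30 := by omega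
        _ ≤ m * (D + 1) * m + u ^ 30 := by gcongr
        _ = m ^ 2 * (D + 1) + u ^ 30 := by ring
    have h5 : 16 * u ^ 40 ≤ u ^ 40 + 640 * m ^ 3 + 640 * m * u ^ 30 + 640 * m + 16 := by
      calc 16 * u ^ 40 ≤ 16 * (40 * m * (m ^ 2 * (D + 1) + u ^ 30) + 40 * m + 1) := by
            refine Nat.mul_le_mul_left _ (h2.trans ?_)
            gcongr
        _ = D * δ + 640 * m ^ 3 + 640 * m * u ^ 30 + 640 * m + 16 := by rw [hδ]; ring
        _ ≤ _ := by gcongr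
    have h640 : 640 ≤ u ^ 5 := by
      calc 640 ≤ 4 ^ 5 := by norm_num
        _ ≤ u ^ 5 := Nat.pow_le_pow_left hu4 5
    have hpow : ∀ k, k ≤ 40 → u ^ k ≤ u ^ 40 := fun k hk =>
      Nat.pow_le_pow_right (by omega) hk
    have e1 : 640 * m ^ 3 ≤ u ^ 40 := by
      calc 640 * m ^ 3 ≤ u ^ 5 * u ^ 3 := by gcongr
        _ = u ^ 8 := by ring
        _ ≤ u ^ 40 := hpow 8 (by norm_num)
    have e2 : 640 * m * u ^ 30 ≤ u ^ 40 := by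
      calc 640 * m * u ^ 30 ≤ u ^ 5 * u * u ^ 30 := by gcongr
        _ = u ^ 36 := by ring
        _ ≤ u ^ 40 := hpow 36 (by norm_num)
    have e3 : 640 * m ≤ u ^ 40 := by
      calc 640 * m ≤ u ^ 5 * u := by gcongr
        _ = u ^ 6 := by ring
        _ ≤ u ^ 40 := hpow 6 (by norm_num)
    have e4 := hpow 5 (by norm_num)
    omega
  obtain ⟨y, -, hy⟩ := Finset.exists_lt_card_fiber_of_mul_lt_card_of_maps_to hmaps hcard
  refine ⟨_, hy, fun q hq => ?_, fun q hq q' hq' => ?_⟩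
  · simp only [hP, Finset.mem_filter, Finset.mem_Ioc] at hq
    exact ⟨hq.1.2, hq.1.1⟩
  · have h1 := (Finset.mem_filter.mp hq).2.trans (Finset.mem_filter.mp hq').2.symm
    rw [Prod.mk.injEq] at h1
    refine ⟨h1.1, ?_⟩
    have h2 := Nat.div_add_mod q δ
    have h3 := Nat.div_add_mod q' δ
    have h4 := Nat.mod_lt q' hδ0
    rw [h1.2] at h2
    omega

lemma prime_mul_bound {Y t : ℕ} (hY : t + 1 ≤ Y) :
    (Y ^ t) ^ (1 + (t + 1) * (t + 1) * Y ^ t) * Y ≤ Y ^ Y ^ (t + 5) := by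
  have hY0 : 0 < Y := by omega
  have hYt : 1 ≤ Y ^ t := Nat.one_le_pow _ _ hY0
  rw [← pow_mul, ← pow_succ]
  refine Nat.pow_le_pow_right hY0 ?_
  calc t * (1 + (t + 1) * (t + 1) * Y ^ t) + 1
      = (t + 1) * 1 + t * ((t + 1) * (t + 1)) * Y ^ t := by ring
    _ ≤ (t + 1) * Y ^ t + t * ((t + 1) * (t + 1)) * Y ^ t := by gcongr
    _ ≤ (t + 1) * ((t + 1) * (t + 1)) * Y ^ t + t * ((t + 1) * (t + 1)) * Y ^ t := by
        gcongr
        exact Nat.le_mul_of_pos_right _ (by positivity)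
    _ = (2 * t + 1) * ((t + 1) * (t + 1)) * Y ^ t := by ring
    _ ≤ (Y * Y) * (Y * Y) * Y ^ t := by
        gcongr
        nlinarith
    _ ≤ (Y * Y) * (Y * Y) * Y ^ t * Y := Nat.le_mul_of_pos_right _ hY0
    _ = Y ^ (t + 5) := by ring

lemma small_prime_bound {Y t : ℕ} (hY : t + 2 ≤ Y) :
    (Y ^ (Y + 2)) ^ (2 * t + 1) ≤ Y ^ Y ^ (t + 5) := by
  have hY0 : 0 < Y := by omega
  rw [← pow_mul]
  refine Nat.pow_le_pow_right hY0 ?_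
  calc (Y + 2) * (2 * t + 1) ≤ (Y * Y) * (Y * Y) := by
        gcongr <;> nlinarith
    _ = Y ^ 4 := by ring
    _ ≤ Y ^ (t + 5) := Nat.pow_le_pow_right hY0 (by omega)

lemma smooth_bound_lt {m M : ℕ} (hm : 2 ≤ m) (hMm : M + 1 = m) :
    ∃ k, (2 * (640 * m ^ 4) * M * (2 ^ (41 * m)) ^ (640 * m ^ 4)) ^ (M + 1) < 2 ^ k ∧
      k + 2 ^ (21 * m) ≤ (2 ^ (29 * m)).primeCounting := by
  set u := 2 ^ m with hu
  have hum : m ≤ u := Nat.lt_two_pow_self.le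
  have hu4 : 4 ≤ u := by
    calc 4 = 2 ^ 2 := rfl
      _ ≤ 2 ^ m := Nat.pow_le_pow_right (by norm_num) hm
  have hp : ∀ k, 2 ^ (k * m) = u ^ k := fun k => by rw [mul_comm, pow_mul]
  have h4 : ∀ k, 4 ^ k ≤ u ^ k := fun k => Nat.pow_le_pow_left hu4 k
  have hpow : ∀ {k l}, k ≤ l → u ^ k ≤ u ^ l := fun h => Nat.pow_le_pow_right (by omega) h
  refine ⟨u ^ 14, ?_, ?_⟩
  · have hA : 2 * (640 * m ^ 4) * M < 2 ^ (11 * m) := by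
      calc 2 * (640 * m ^ 4) * M < 2 * (640 * m ^ 4) * m := by
            have : 0 < 2 * (640 * m ^ 4) := by positivity
            exact Nat.mul_lt_mul_of_pos_left (by omega) this
        _ = 1280 * m ^ 5 := by ring
        _ ≤ u ^ 6 * u ^ 5 := by
            have := h4 6
            gcongr
            omega
        _ = 2 ^ (11 * m) := by rw [hp]; ring
    calc (2 * (640 * m ^ 4) * M * (2 ^ (41 * m)) ^ (640 * m ^ 4)) ^ (M + 1)
        < (2 ^ (11 * m) * (2 ^ (41 * m)) ^ (640 * m ^ 4)) ^ (M + 1) := by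
          refine Nat.pow_lt_pow_left ?_ (by omega)
          exact Nat.mul_lt_mul_of_pos_right hA (by positivity)
      _ = 2 ^ (11 * m ^ 2 + 26240 * m ^ 6) := by
          rw [hMm, ← pow_mul, ← pow_add, ← pow_mul]
          congr 1
          ring
      _ ≤ 2 ^ (u ^ 14) := by
          refine Nat.pow_le_pow_right (by norm_num) ?_
          calc 11 * m ^ 2 + 26240 * m ^ 6 ≤ 11 * m ^ 6 + 26240 * m ^ 6 := by
                gcongr <;> omega
            _ = 26251 * m ^ 6 := by ring
            _ ≤ u ^ 8 * u ^ 6 := by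
                have := h4 8
                gcongr
                omega
            _ = u ^ 14 := by ring
  · by_contra! hcon
    have h2 := two_pow_le_primeCounting (x := 29 * m) (by omega)
    rw [hp 29] at h2 hcon
    rw [hp 21] at hcon
    have h3 : u ^ 29 ≤ u ^ 29 / 2 := by
      have h29 : 29 * m ≤ u ^ 4 := by
        calc 29 * m ≤ u ^ 3 * u := by
              have := h4 3
              gcongr
              omega
          _ = u ^ 4 := by ring
      refine h2.trans ?_
      calc 29 * m * (u ^ 29).primeCounting + 29 * m + 1
          ≤ u ^ 4 * (u ^ 14 + u ^ 21) + u ^ 4 + 1 := by gcongr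
        _ = u ^ 18 + u ^ 25 + u ^ 4 + 1 := by ring
        _ ≤ u ^ 25 + u ^ 25 + u ^ 25 + u ^ 25 := by
            have h5 := hpow (show 18 ≤ 25 by norm_num)
            have h6 := hpow (show 4 ≤ 25 by norm_num)
            have h7 := hpow (show 0 ≤ 25 by norm_num)
            rw [pow_zero] at h7
            omega
        _ ≤ u ^ 29 / 2 := by
            rw [Nat.le_div_iff_mul_le (by norm_num)]
            have h8 := h4 4
            have h9 : u ^ 29 = u ^ 25 * u ^ 4 := by ring
            rw [h9]
            nlinarith [Nat.zero_le (u ^ 25)]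
    have h10 : 0 < u ^ 29 := by positivity
    omega

theorem exists_drop_le_mul {t : ℕ} {r : ℕ → ℤ} {M a Y : ℕ} (ht : 1 ≤ t)
    (hper : ∀ i, 1 ≤ i → r (i + t) = r i) (hnz : ∃ i, 1 ≤ i ∧ r i ≠ 0)
    (hM : ∀ i, 1 ≤ i → (r i).natAbs ≤ M) (htM : t ≤ M) (ha : 1 ≤ a)
    (hY : Y = 2 ^ (41 * (M + 1))) :
    ∃ b, a < b ∧ b ≤ a * Y ^ Y ^ (t + 5) ∧ vab r a b < vab r a (b - 1) := by
  by_contra! hno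
  obtain ⟨m, hm⟩ : ∃ m, m = M + 1 := ⟨_, rfl⟩
  rw [← hm] at hY
  have hm2 : 2 ≤ m := by omega
  have hmt : t < m := by omega
  set u := 2 ^ m with hu
  have hum : m < u := Nat.lt_two_pow_self
  have hu4 : 4 ≤ u := by
    calc 4 = 2 ^ 2 := rfl
      _ ≤ 2 ^ m := Nat.pow_le_pow_right (by norm_num) hm2
  have hp : ∀ k, 2 ^ (k * m) = u ^ k := fun k => by rw [mul_comm, pow_mul]
  have hpow : ∀ {k l}, k ≤ l → u ^ k ≤ u ^ l := fun h => Nat.pow_le_pow_right (by omega) h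
  obtain ⟨Q, hQcard, hQ, hclose⟩ := exists_close_primes hm2 ht (by omega : t ≤ m)
  obtain ⟨k, hk1, hk2⟩ := smooth_bound_lt hm2 hm.symm
  simp only [hp] at hQ hY hk1 hk2
  have hYu : u ≤ Y := by
    rw [hY]
    exact Nat.le_self_pow (by norm_num) u
  have huu : u * u ≤ u ^ 30 := by
    calc u * u = u ^ 2 := by ring
      _ ≤ u ^ 30 := hpow (by norm_num)
  have hu30 : u ≤ u ^ 30 := Nat.le_self_pow (by norm_num) u
  obtain ⟨q₀, hq₀⟩ : Q.Nonempty := Finset.card_pos.mp (by omega)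
  have hMq : ∀ q ∈ Q, M < q := fun q hq => by
    have := (hQ q hq).2.1
    omega
  obtain ⟨w, hw, hwt, hrw⟩ := exists_mul_apply_ne_zero ht hper hnz (u := q₀)
    (hQ q₀ hq₀).1.one_le (((hQ q₀ hq₀).1.coprime_iff_not_dvd).mpr fun h => by
      have := Nat.le_of_dvd ht h
      have := hMq q₀ hq₀
      omega)
  have hr : ∀ q ∈ Q, r (q * w) ≠ 0 := fun q hq => by
    rw [eq_of_modEq_of_periodic hper (Nat.mul_pos (hQ q hq).1.pos hw)
      (Nat.mul_pos (hQ q₀ hq₀).1.pos hw) ((hclose q hq q₀ hq₀).1.mul_right w)]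
    exact hrw
  have hqN : ∀ q ∈ Q, q * w ≤ Y := fun q hq => by
    calc q * w ≤ u ^ 40 * u := Nat.mul_le_mul (hQ q hq).2.2 (by omega)
      _ = Y := by rw [hY]; ring
  have htu : (t + 1) * (t + 1) ≤ u * u := Nat.mul_le_mul (by omega) (by omega)
  have hsmooth : ∀ q ∈ Q, _ := fun q hq => psum_smooth_of_noDrop (q := q) (w := w) ht hper hnz hM
    htM ha hno (hQ q hq).1 (hMq q hq) (by have := (hQ q hq).2.1; omega) hw hwt (hr q hq)
    (hqN q hq) (prime_mul_bound (by omega)) (small_prime_bound (by omega))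
  have hC₂ : (Y ^ (Y + 2)) ^ (2 * t + 1) ≤ Y ^ Y ^ (t + 5) := small_prime_bound (by omega)
  refine false_of_many_smooth_sums (h := 640 * m ^ 4) (N := Y) hM (by omega) ?_ (by omega) hw
    (by omega) (fun q hq => (hQ q hq).1) hMq hr hqN ?_ ?_ (fun q hq => (hsmooth q hq).1)
    (fun q hq => (hsmooth q hq).2) ?_
  · have : 0 < 640 * m ^ 4 := by positivity
    omega
  · intro q hq q' hq' _
    calc q' * w ≤ (q + 640 * m ^ 3) * w := Nat.mul_le_mul_right _ (hclose q hq q' hq').2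
      _ = q * w + 640 * m ^ 3 * w := by ring
      _ ≤ q * w + 640 * m ^ 3 * m := by
          gcongr
          omega
      _ = q * w + 640 * m ^ 4 := by ring
  · intro q hq
    refine lt_of_le_of_lt ?_ (hQ q hq).2.1
    calc 640 * m ^ 4 ≤ u ^ 5 * u ^ 4 := by
          have : 4 ^ 5 ≤ u ^ 5 := Nat.pow_le_pow_left hu4 5
          gcongr
          omega
      _ = u ^ 9 := by ring
      _ ≤ u ^ 30 := hpow (by norm_num)
  · intro q hq
    rw [hY]
    refine hk1.trans_le (two_pow_le_of_primes_dvd (Rat.den_ne_zero _) hk2 fun p hpp hlo hhi => ?_)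
    have hqlo : u ^ 30 < q * w := (hQ q hq).2.1.trans_le (Nat.le_mul_of_pos_right _ hw)
    refine dvd_den_psum_one_of_noDrop ht hper hnz hM htM ha hno hpp ?_ ?_ ?_
      ((Nat.pow_le_pow_left ?_ _).trans hC₂)
    · have : u ≤ u ^ 21 := Nat.le_self_pow (by norm_num) u
      omega
    · calc t * p ≤ u * u ^ 29 := Nat.mul_le_mul (by omega) hhi
        _ = u ^ 30 := by ring
        _ ≤ q * w := hqlo.le
    · calc q * w ≤ u ^ 40 * u := Nat.mul_le_mul (hQ q hq).2.2 (by omega)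
        _ = u ^ 41 := by ring
        _ ≤ u ^ 42 := hpow (by norm_num)
        _ = u ^ 21 * u ^ 21 := by ring
        _ < p * p := Nat.mul_lt_mul'' hlo hlo
    · calc p ≤ u ^ 29 := hhi
        _ ≤ u ^ 41 := hpow (by norm_num)
        _ = Y := hY.symm
        _ ≤ Y ^ (Y + 2) := Nat.le_self_pow (by omega) Y

lemma two_pow_tower_lt_exp {t m : ℕ} (ht : 1 ≤ t) (htm : t < m) :
    (((2 ^ (41 * m)) ^ (2 ^ (41 * m)) ^ (t + 5) : ℕ) : ℝ) <
      Real.exp (Real.exp (Real.exp ((m : ℕ) * (4 + 7 / Real.log (m : ℕ))))) := by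
  have hm2 : (2 : ℝ) ≤ m := by exact_mod_cast (by omega : 2 ≤ m)
  have htm' : (t : ℝ) + 1 ≤ m := by exact_mod_cast htm
  have hlog : 0 < Real.log m := Real.log_pos (by linarith)
  have hlogm : Real.log m ≤ m := Real.log_le_self (by linarith)
  have h7 : 7 ≤ m * (7 / Real.log m) := by
    rw [mul_div_assoc', le_div_iff₀ hlog]
    linarith
  set y : ℝ := 41 * m * Real.log 2 with hy
  have hl2 : Real.log 2 < 1 := by
    have := Real.log_two_lt_d9
    linarith
  have hl2' : 0 < Real.log 2 := Real.log_pos one_lt_two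
  have hY : ((2 : ℝ) ^ (41 * m)) = Real.exp y := by
    rw [hy, show 41 * (m : ℝ) = ((41 * m : ℕ) : ℝ) by push_cast; rfl, Real.exp_nat_mul,
      Real.exp_log two_pos]
  push_cast
  rw [← Real.exp_log (show (0 : ℝ) < (2 ^ (41 * m)) ^ (2 ^ (41 * m)) ^ (t + 5) by positivity),
    Real.log_pow, hY, Real.log_exp, Real.exp_lt_exp]
  push_cast
  rw [hY, ← Real.exp_nat_mul]
  have hy1 : y ≤ Real.exp y := by
    have := Real.add_one_le_exp y
    linarith
  calc Real.exp (((t + 5 : ℕ) : ℝ) * y) * y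
      ≤ Real.exp (((t + 5 : ℕ) : ℝ) * y) * Real.exp y := by gcongr
    _ = Real.exp ((t + 6) * y) := by
        rw [← Real.exp_add]
        congr 1
        push_cast
        ring
    _ < _ := by
        rw [Real.exp_lt_exp]
        calc (t + 6) * y ≤ (m + 5) * (41 * m) := by
              have h1 : y ≤ 41 * m := by nlinarith
              exact mul_le_mul (by linarith) h1 (by positivity) (by positivity)
          _ < 128 * (m + 1) ^ 4 := by
              have h1 : (9 : ℝ) ≤ (m + 1) ^ 2 := by nlinarith
              have h2 : ((m : ℝ) + 1) ^ 4 = (m + 1) ^ 2 * (m + 1) ^ 2 := by ring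
              nlinarith
          _ ≤ Real.exp 7 * Real.exp m ^ 4 := by
              have h1 : (2 : ℝ) ≤ Real.exp 1 := by
                have := Real.add_one_le_exp (1 : ℝ)
                linarith
              have h2 : (128 : ℝ) ≤ Real.exp 7 := by
                calc (128 : ℝ) = 2 ^ 7 := by norm_num
                  _ ≤ Real.exp 1 ^ 7 := by gcongr
                  _ = Real.exp 7 := by
                      rw [← Real.exp_nat_mul]
                      norm_num
              have h3 := Real.add_one_le_exp (m : ℝ)
              gcongr
          _ = Real.exp (7 + 4 * m) := by
              rw [← Real.exp_nat_mul, ← Real.exp_add]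
              norm_num
          _ ≤ _ := by
              rw [Real.exp_le_exp]
              linarith

lemma natAbs_le_rstar {t : ℕ} {r : ℕ → ℤ} (ht : 1 ≤ t)
    (hper : ∀ i, 1 ≤ i → r (i + t) = r i) {i : ℕ} (hi : 1 ≤ i) :
    (r i).natAbs ≤ rstar r t := by
  have hmod := Nat.mod_lt (i - 1) ht
  have heq : r i = r ((i - 1) % t + 1) := by
    refine eq_of_modEq_of_periodic hper hi (by omega) ?_
    have h1 : (i - 1) + 1 ≡ (i - 1) % t + 1 [MOD t] := (Nat.mod_modEq _ _).symm.add_right 1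
    rwa [Nat.sub_add_cancel hi] at h1
  rw [heq]
  exact Finset.le_sup (f := fun i => (r i).natAbs) (Finset.mem_Icc.mpr ⟨by omega, by omega⟩)

/-- With `m = 1 + max(r*, t)` and `c = exp(exp(exp(m(4 + 7/log m))))`, for every `a ≥ 1`
there is `b` with `a < b < c·a` and `v_{a,b} < v_{a,b-1}`. -/
theorem exists_denominator_drop_linear
    (t : ℕ) (r : ℕ → ℤ) (ht : 1 ≤ t)
    (hper : ∀ i, 1 ≤ i → r (i + t) = r i)
    (hnz : ∃ i, 1 ≤ i ∧ r i ≠ 0) :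
    ∀ a : ℕ, 1 ≤ a →
      ∃ b : ℕ, a < b ∧
        (b : ℝ) < Real.exp (Real.exp (Real.exp ((1 + max (rstar r t) t : ℕ) *
          (4 + 7 / Real.log (1 + max (rstar r t) t : ℕ))))) * a ∧
        vab r a b < vab r a (b - 1) := by
  intro a ha
  obtain ⟨b, hab, hb, hv⟩ := exists_drop_le_mul (M := max (rstar r t) t) ht hper hnz
    (fun i hi => (natAbs_le_rstar ht hper hi).trans (le_max_left _ _)) (le_max_right _ _) ha rfl
  refine ⟨b, hab, ?_, hv⟩
  have hlt := two_pow_tower_lt_exp (t := t) (m := 1 + max (rstar r t) t) ht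
    (by have := le_max_right (rstar r t) t; omega)
  have ha' : (0 : ℝ) < a := by exact_mod_cast ha
  rw [add_comm (max (rstar r t) t) 1] at hb
  calc (b : ℝ) ≤ ((a * (2 ^ (41 * (1 + max (rstar r t) t))) ^
        (2 ^ (41 * (1 + max (rstar r t) t))) ^ (t + 5) : ℕ) : ℝ) := by exact_mod_cast hb
    _ = (((2 ^ (41 * (1 + max (rstar r t) t))) ^
        (2 ^ (41 * (1 + max (rstar r t) t))) ^ (t + 5) : ℕ) : ℝ) * a := by
        rw [Nat.cast_mul, mul_comm]
    _ < _ := mul_lt_mul_of_pos_right hlt ha'
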